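/- arXiv:1302.3678 — 2 statements merged into one kernel-verified Lean document; each statement's English description precedes it below -/
import Mathlib

section
/- (Wolstenholme's theorem.) Let p be a prime with p > 3. Then the sum over i from 1 to p-1 of the multiplicative inverse of i modulo p^2 is congruent to 0 modulo p^2. -/
theorem ZMod.natCast_mul_eq_zero_of_castHom_eq_zero {p : ℕ} [NeZero p] {t : ZMod (p ^ 2)}
    (ht : ZMod.castHom (dvd_pow_self p two_ne_zero) (ZMod p) t = 0) :
    (p : ZMod (p ^ 2)) * t = 0 := by
  obtain ⟨n, rfl⟩ := ZMod.natCast_zmod_surjective t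
  rw [map_natCast, ZMod.natCast_eq_zero_iff] at ht
  rw [← Nat.cast_mul, ZMod.natCast_eq_zero_iff, pow_two]
  exact mul_dvd_mul_left p ht

theorem ZMod.sum_Icc_inv_sq_eq_zero {p : ℕ} [Fact p.Prime] (hp3 : 3 < p) :
    ∑ i ∈ Finset.Icc 1 (p - 1), ((i : ZMod p)⁻¹) ^ 2 = 0 := by
  have hsum : ∑ x : ZMod p, x⁻¹ ^ 2 = 0 :=
    (Equiv.sum_comp (Equiv.inv (ZMod p)) (fun x => x ^ 2)).trans
      (FiniteField.sum_pow_lt_card_sub_one (ZMod p) 2 (by rw [ZMod.card]; omega))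
  rw [← Finset.sum_erase Finset.univ (a := (0 : ZMod p)) (by simp)] at hsum
  rw [← hsum]
  refine Finset.sum_nbij' (fun i => (i : ZMod p)) ZMod.val ?_ ?_ ?_ ?_ (fun _ _ => rfl)
  · intro i hi
    rw [Finset.mem_Icc] at hi
    simp only [Finset.mem_erase, Finset.mem_univ, and_true, ne_eq, ZMod.natCast_eq_zero_iff]
    exact Nat.not_dvd_of_pos_of_lt hi.1 (by omega)
  · intro x hx
    have h0 : x.val ≠ 0 := by simpa [ZMod.val_eq_zero] using hx
    have := ZMod.val_lt x
    rw [Finset.mem_Icc]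
    omega
  · intro i hi
    rw [Finset.mem_Icc] at hi
    exact ZMod.val_natCast_of_lt (by omega)
  · exact fun x _ => ZMod.natCast_zmod_val x

theorem wolstenholme (p : ℕ) (hp : p.Prime) (hp3 : 3 < p) :
    ∑ i ∈ Finset.Icc 1 (p - 1), (i : ZMod (p ^ 2))⁻¹ = 0 := by
  have : Fact p.Prime := ⟨hp⟩
  have hinv : ∀ i ∈ Finset.Icc 1 (p - 1), (i : ZMod (p ^ 2)) * (i : ZMod (p ^ 2))⁻¹ = 1 := by
    intro i hi
    rw [Finset.mem_Icc] at hi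
    exact ZMod.coe_mul_inv_eq_one i
      ((Nat.coprime_of_lt_prime (by omega) (by omega) hp).symm.pow_right 2)
  have hmem : ∀ i ∈ Finset.Icc 1 (p - 1), p - i ∈ Finset.Icc 1 (p - 1) := by
    intro i hi
    rw [Finset.mem_Icc] at hi ⊢
    omega
  have hreflect : ∑ i ∈ Finset.Icc 1 (p - 1), ((p - i : ℕ) : ZMod (p ^ 2))⁻¹ =
      ∑ i ∈ Finset.Icc 1 (p - 1), (i : ZMod (p ^ 2))⁻¹ := by
    refine Finset.sum_nbij' (fun i => p - i) (fun i => p - i) hmem hmem ?_ ?_ (fun _ _ => rfl) <;>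
    · intro i hi
      rw [Finset.mem_Icc] at hi
      omega
  have hdouble : 2 * ∑ i ∈ Finset.Icc 1 (p - 1), (i : ZMod (p ^ 2))⁻¹ =
      p * ∑ i ∈ Finset.Icc 1 (p - 1),
        (i : ZMod (p ^ 2))⁻¹ * ((p - i : ℕ) : ZMod (p ^ 2))⁻¹ := by
    rw [two_mul]
    nth_rewrite 2 [← hreflect]
    rw [← Finset.sum_add_distrib, Finset.mul_sum]
    refine Finset.sum_congr rfl fun i hi => ?_
    have h₁ := hinv i hi
    have h₂ := hinv _ (hmem i hi)
    rw [Finset.mem_Icc] at hi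
    have hadd : (i : ZMod (p ^ 2)) + ((p - i : ℕ) : ZMod (p ^ 2)) = p := by
      rw [← Nat.cast_add, Nat.add_sub_cancel' (by omega)]
    rw [← hadd]
    linear_combination -((p - i : ℕ) : ZMod (p ^ 2))⁻¹ * h₁ - (i : ZMod (p ^ 2))⁻¹ * h₂
  have hzero : 2 * ∑ i ∈ Finset.Icc 1 (p - 1), (i : ZMod (p ^ 2))⁻¹ = 0 := by
    rw [hdouble]
    apply ZMod.natCast_mul_eq_zero_of_castHom_eq_zero
    rw [map_sum, ← neg_eq_zero, ← Finset.sum_neg_distrib, ← ZMod.sum_Icc_inv_sq_eq_zero hp3]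
    refine Finset.sum_congr rfl fun i hi => ?_
    have hcast : ∀ j ∈ Finset.Icc 1 (p - 1),
        ZMod.castHom (dvd_pow_self p two_ne_zero) (ZMod p) (j : ZMod (p ^ 2))⁻¹ =
          (j : ZMod p)⁻¹ := by
      intro j hj
      refine eq_inv_of_mul_eq_one_right ?_
      rw [← map_natCast (ZMod.castHom (dvd_pow_self p two_ne_zero) (ZMod p)) j, ← map_mul,
        hinv j hj, map_one]
    rw [map_mul, hcast i hi, hcast _ (hmem i hi)]
    rw [Finset.mem_Icc] at hi
    rw [Nat.cast_sub (by omega), CharP.cast_eq_zero (ZMod p) p, zero_sub, inv_neg]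
    ring
  have htwo : IsUnit (2 : ZMod (p ^ 2)) :=
    IsUnit.of_mul_eq_one _ (by simpa using hinv 2 (Finset.mem_Icc.mpr ⟨by omega, by omega⟩))
  exact htwo.mul_right_eq_zero.mp hzero
end

section
/- Let p be a prime with p > 3, and write H = Σ_{i=1}^{(p-1)/2} 1/i, where 1/a denotes the multiplicative inverse of a modulo p^3. Then, modulo p^3, (-1)^((p-1)/2) · C(p-1, (p-1)/2) is congruent to 1 - p·H + (p^2/2)·H^2, where 1/2 denotes the inverse of 2 modulo p^3. -/
/-- Expansion of `∏ (1 - x * f i)` to second order when `x ^ 3 = 0`, with denominators cleared. -/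
theorem two_mul_prod_one_sub_mul_of_pow_three_eq_zero {R ι : Type*} [CommRing R] {x : R}
    (hx : x ^ 3 = 0) (s : Finset ι) (f : ι → R) :
    2 * ∏ i ∈ s, (1 - x * f i) =
      2 - 2 * x * ∑ i ∈ s, f i + x ^ 2 * ((∑ i ∈ s, f i) ^ 2 - ∑ i ∈ s, f i ^ 2) := by
  classical
  induction s using Finset.induction_on with
  | empty => simp
  | insert a s ha ih =>
    rw [Finset.prod_insert ha, Finset.sum_insert ha, Finset.sum_insert ha]
    linear_combination (1 - x * f a) * ih -
      f a * ((∑ i ∈ s, f i) ^ 2 - ∑ i ∈ s, f i ^ 2) * hx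

theorem natCast_mul_inv_zmod_prime_pow {p : ℕ} (hp : p.Prime) (n : ℕ) {i : ℕ} (h0 : 0 < i)
    (hi : i < p) : (i : ZMod (p ^ n)) * (i : ZMod (p ^ n))⁻¹ = 1 :=
  ZMod.coe_mul_inv_eq_one i ((Nat.coprime_of_lt_prime h0.ne' hi hp).symm.pow_right n)

theorem neg_one_pow_mul_choose_prime_sub_one {p : ℕ} (hp : p.Prime) (n : ℕ) {k : ℕ}
    (hk : k < p) :
    (-1 : ZMod (p ^ n)) ^ k * ((p - 1).choose k : ZMod (p ^ n)) =
      ∏ i ∈ Finset.Icc 1 k, (1 - (p : ZMod (p ^ n)) * (i : ZMod (p ^ n))⁻¹) := by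
  induction k with
  | zero => simp
  | succ k ih =>
    rw [Finset.prod_Icc_succ_top (by omega), ← ih (by omega)]
    have hinv := natCast_mul_inv_zmod_prime_pow hp n k.succ_pos hk
    have hsub : ((p - 1 - k : ℕ) : ZMod (p ^ n)) = p - (k + 1 : ℕ) := by
      rw [← Nat.cast_sub hk.le]
      congr 1
      omega
    have h := congrArg (Nat.cast : ℕ → ZMod (p ^ n)) (Nat.choose_succ_right_eq (p - 1) k)
    rw [Nat.cast_mul, Nat.cast_mul, hsub] at h
    rw [pow_succ]
    linear_combination (-(-1 : ZMod (p ^ n)) ^ k * ((k + 1 : ℕ) : ZMod (p ^ n))⁻¹) * h +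
      (-1 : ZMod (p ^ n)) ^ k *
        (((p - 1).choose (k + 1) : ZMod (p ^ n)) + ((p - 1).choose k : ZMod (p ^ n))) * hinv

theorem sum_range_inv_sq_zmod_prime {p : ℕ} [Fact p.Prime] (hp3 : 3 < p) :
    ∑ i ∈ Finset.range p, ((i : ZMod p)⁻¹) ^ 2 = 0 := by
  have h : ∑ x : ZMod p, (x⁻¹) ^ 2 = 0 := by
    rw [← FiniteField.sum_pow_lt_card_sub_one (ZMod p) 2 (by rw [ZMod.card]; omega)]
    exact Equiv.sum_comp (Equiv.inv (ZMod p)) fun x => x ^ 2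
  rw [← h]
  refine Finset.sum_nbij' (fun i => (i : ZMod p)) ZMod.val ?_ ?_ ?_ ?_ ?_
  · simp
  · simp [ZMod.val_lt]
  · intro i hi
    exact ZMod.val_cast_of_lt (Finset.mem_range.mp hi)
  · simp
  · simp

theorem sum_Icc_half_inv_sq_zmod_prime {p : ℕ} [hp : Fact p.Prime] (hp3 : 3 < p) :
    ∑ i ∈ Finset.Icc 1 ((p - 1) / 2), ((i : ZMod p)⁻¹) ^ 2 = 0 := by
  obtain ⟨m, hm⟩ := hp.out.odd_of_ne_two (by omega)
  have h := sum_range_inv_sq_zmod_prime hp3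
  have h2 : (2 : ZMod p) ≠ 0 := by
    intro h
    have := (ZMod.natCast_eq_zero_iff 2 p).mp (by exact_mod_cast h)
    exact absurd (Nat.le_of_dvd two_pos this) (by omega)
  have hr : Finset.range p = Finset.range (m + m + 1) := by rw [hm, two_mul]
  rw [hr, Finset.sum_range_succ', Finset.sum_range_add] at h
  have hrefl : ∑ i ∈ Finset.range m, (((m + i + 1 : ℕ) : ZMod p)⁻¹) ^ 2 =
      ∑ i ∈ Finset.range m, (((i + 1 : ℕ) : ZMod p)⁻¹) ^ 2 := by
    rw [← Finset.sum_range_reflect]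
    refine Finset.sum_congr rfl fun i hi => ?_
    have hi := Finset.mem_range.mp hi
    have hadd : m + (m - 1 - i) + 1 + (i + 1) = p := by omega
    have hcast : ((m + (m - 1 - i) + 1 : ℕ) : ZMod p) = -((i + 1 : ℕ) : ZMod p) := by
      rw [eq_neg_iff_add_eq_zero, ← Nat.cast_add, hadd, ZMod.natCast_self]
    rw [hcast, inv_neg, neg_sq]
  rw [hrefl] at h
  have hIcc : ∑ i ∈ Finset.Icc 1 ((p - 1) / 2), ((i : ZMod p)⁻¹) ^ 2 =
      ∑ i ∈ Finset.range m, (((i + 1 : ℕ) : ZMod p)⁻¹) ^ 2 := by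
    rw [Finset.range_eq_Ico, Finset.sum_Ico_add' (fun i : ℕ => ((i : ZMod p)⁻¹) ^ 2) 0 m 1]
    refine Finset.sum_congr ?_ fun _ _ => rfl
    ext i
    simp only [Finset.mem_Icc, Finset.mem_Ico]
    omega
  rw [hIcc]
  refine (mul_eq_zero.mp ?_).resolve_left h2
  simpa [two_mul] using h

theorem pow_mul_eq_zero_of_castHom_eq_zero {p n : ℕ} [NeZero p] (x : ZMod (p ^ (n + 1)))
    (hx : ZMod.castHom (dvd_pow_self p n.succ_ne_zero) (ZMod p) x = 0) :
    (p : ZMod (p ^ (n + 1))) ^ n * x = 0 := by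
  obtain ⟨a, rfl⟩ := ZMod.natCast_zmod_surjective x
  rw [map_natCast, ZMod.natCast_eq_zero_iff] at hx
  obtain ⟨b, rfl⟩ := hx
  have h : (p : ZMod (p ^ (n + 1))) ^ (n + 1) = 0 := by
    rw [← Nat.cast_pow, ZMod.natCast_self]
  rw [Nat.cast_mul, ← mul_assoc, ← pow_succ, h, zero_mul]

theorem central_binom_mod_cube (p : ℕ) (hp : p.Prime) (hp3 : 3 < p)
    (H : ZMod (p ^ 3)) (hH : H = ∑ i ∈ Finset.Icc 1 ((p - 1) / 2), (i : ZMod (p ^ 3))⁻¹) :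
    (-1 : ZMod (p ^ 3)) ^ ((p - 1) / 2) * (Nat.choose (p - 1) ((p - 1) / 2) : ZMod (p ^ 3))
      = 1 - (p : ZMod (p ^ 3)) * H + (p : ZMod (p ^ 3)) ^ 2 * (2 : ZMod (p ^ 3))⁻¹ * H ^ 2 := by
  have : Fact p.Prime := ⟨hp⟩
  have hcube : (p : ZMod (p ^ 3)) ^ 3 = 0 := by rw [← Nat.cast_pow, ZMod.natCast_self]
  have h2 : (2 : ZMod (p ^ 3)) * 2⁻¹ = 1 :=
    mod_cast natCast_mul_inv_zmod_prime_pow hp 3 (i := 2) two_pos (by omega)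
  have hsq : (p : ZMod (p ^ 3)) ^ 2 *
      ∑ i ∈ Finset.Icc 1 ((p - 1) / 2), ((i : ZMod (p ^ 3))⁻¹) ^ 2 = 0 := by
    apply pow_mul_eq_zero_of_castHom_eq_zero
    rw [← sum_Icc_half_inv_sq_zmod_prime hp3, map_sum]
    refine Finset.sum_congr rfl fun i hi => ?_
    obtain ⟨hi1, hi2⟩ := Finset.mem_Icc.mp hi
    rw [map_pow]
    congr 1
    apply eq_inv_of_mul_eq_one_right
    have h := congrArg (ZMod.castHom (dvd_pow_self p three_ne_zero) (ZMod p))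
      (natCast_mul_inv_zmod_prime_pow hp 3 hi1 (by omega))
    rwa [map_mul, map_natCast, map_one] at h
  have hprod := two_mul_prod_one_sub_mul_of_pow_three_eq_zero hcube
    (Finset.Icc 1 ((p - 1) / 2)) fun i : ℕ => (i : ZMod (p ^ 3))⁻¹
  rw [← neg_one_pow_mul_choose_prime_sub_one hp 3 (by omega), ← hH] at hprod
  generalize (-1 : ZMod (p ^ 3)) ^ ((p - 1) / 2) *
    (Nat.choose (p - 1) ((p - 1) / 2) : ZMod (p ^ 3)) = y at hprod ⊢
  linear_combination (2 : ZMod (p ^ 3))⁻¹ * hprod - (2 : ZMod (p ^ 3))⁻¹ * hsq -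
    (y - 1 + p * H) * h2
end
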